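/- arXiv:1705.04908 — 5 statements merged into one kernel-verified Lean document; each statement's English description precedes it below -/
import Mathlib

section
/- Let (Ω, F, μ) be a probability space, n a positive integer, K an n×n complex matrix, g₀ ∈ ℂⁿ a fixed vector, and e : ℕ → Ω → ℂⁿ a sequence of random vectors. Define the random vectors y : ℕ → Ω → ℂⁿ by y_0(ω) = g₀ and y_{t+1}(ω) = K y_t(ω) + e_t(ω). Assume E[e_t] = 0 for every t, E[e_{t'} e_tᴴ] = 0 whenever t' ≠ t, and that all outer products appearing are integrable. Then for all t, t' ∈ ℕ with t' ≥ t, the second-moment matrices G_{t',t} = E[y_{t'} y_tᴴ] satisfy G_{t',t} = K^{t'-t} G_{t,t}. -/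
open Matrix MeasureTheory

/-- Affine propagation of second moments: if `v = K u + w`, then `E[v z̄] = K E[u z̄] + E[w z̄]`. -/
theorem integral_mulVec_add_mul_star {Ω : Type*} [MeasurableSpace Ω] {μ : Measure Ω}
    {ι κ : Type*} [Fintype κ] (K : Matrix ι κ ℂ) (u : Ω → κ → ℂ) (w : Ω → ι → ℂ) (z : Ω → ℂ)
    (hu : ∀ k, Integrable (fun ω => u ω k * star (z ω)) μ) (i : ι)
    (hw : Integrable (fun ω => w ω i * star (z ω)) μ) :
    ∫ ω, (K.mulVec (u ω) + w ω) i * star (z ω) ∂μ =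
      ∑ k, K i k * ∫ ω, u ω k * star (z ω) ∂μ + ∫ ω, w ω i * star (z ω) ∂μ := by
  simp only [Pi.add_apply, mulVec, dotProduct, add_mul, Finset.sum_mul, mul_assoc]
  rw [integral_add (integrable_finsetSum _ fun k _ => (hu k).const_mul _) hw,
    integral_finsetSum _ fun k _ => (hu k).const_mul _]
  simp only [integral_const_mul]

/-- Swapping the factors of a cross moment conjugates it. -/
theorem integral_mul_star_comm {Ω : Type*} [MeasurableSpace Ω] {μ : Measure Ω} (f g : Ω → ℂ) :
    ∫ ω, f ω * star (g ω) ∂μ = star (∫ ω, g ω * star (f ω) ∂μ) := by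
  have h := integral_conj (μ := μ) (f := fun ω => g ω * star (f ω))
  simpa [mul_comm] using h

/-- The state of a linear recursion driven by centered uncorrelated noise is uncorrelated with
present and future noise. -/
theorem integral_state_mul_star_noise_eq_zero {Ω : Type*} [MeasurableSpace Ω] {μ : Measure Ω}
    {ι : Type*} [Fintype ι] (K : Matrix ι ι ℂ) (g0 : ι → ℂ) (e y : ℕ → Ω → ι → ℂ)
    (hy0 : ∀ ω, y 0 ω = g0)
    (hyrec : ∀ t ω, y (t + 1) ω = K.mulVec (y t ω) + e t ω)
    (he_mean : ∀ t i, ∫ ω, e t ω i ∂μ = 0)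
    (hee_int : ∀ t' t i j, Integrable (fun ω => e t' ω i * star (e t ω j)) μ)
    (hee : ∀ t' t, t' ≠ t → ∀ i j, ∫ ω, e t' ω i * star (e t ω j) ∂μ = 0)
    (hye_int : ∀ t' t i j, Integrable (fun ω => y t' ω i * star (e t ω j)) μ)
    {t s : ℕ} (hts : t ≤ s) (i j : ι) :
    ∫ ω, y t ω i * star (e s ω j) ∂μ = 0 := by
  induction t generalizing i with
  | zero =>
    rw [integral_mul_star_comm]
    simp only [hy0, integral_mul_const, he_mean, zero_mul, star_zero]
  | succ t ih =>
    simp only [hyrec]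
    rw [integral_mulVec_add_mul_star K (y t) (e t) (fun ω => e s ω j)
      (fun k => hye_int t s k j) i (hee_int t s i j), hee t s (by lia)]
    simp only [ih (by lia), mul_zero, Finset.sum_const_zero, add_zero]

/-- Lemma 1 of the paper, case `t' ≥ t`: the second-moment matrices
`G_{t',t} = E[y_{t'} y_tᴴ]` of the process `y (t+1) = K y t + e t` with zero-mean,
temporally uncorrelated process noise `e` satisfy `G_{t',t} = K^(t'-t) G_{t,t}`.
Expectations of outer products are taken entrywise. -/
theorem stmt_5 {Ω : Type*} [MeasurableSpace Ω] (μ : Measure Ω) [IsProbabilityMeasure μ]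
    (n : ℕ) (hn : 0 < n) (K : Matrix (Fin n) (Fin n) ℂ) (g0 : Fin n → ℂ)
    (e y : ℕ → Ω → Fin n → ℂ)
    (hy0 : ∀ ω, y 0 ω = g0)
    (hyrec : ∀ t ω, y (t + 1) ω = K.mulVec (y t ω) + e t ω)
    (he_int : ∀ t i, Integrable (fun ω => e t ω i) μ)
    (he_mean : ∀ t i, ∫ ω, e t ω i ∂μ = 0)
    (hee_int : ∀ t' t i j, Integrable (fun ω => e t' ω i * star (e t ω j)) μ)
    (hee : ∀ t' t, t' ≠ t → ∀ i j, ∫ ω, e t' ω i * star (e t ω j) ∂μ = 0)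
    (hyy_int : ∀ t' t i j, Integrable (fun ω => y t' ω i * star (y t ω j)) μ)
    (hye_int : ∀ t' t i j, Integrable (fun ω => y t' ω i * star (e t ω j)) μ)
    (hey_int : ∀ t' t i j, Integrable (fun ω => e t' ω i * star (y t ω j)) μ)
    (G : ℕ → ℕ → Matrix (Fin n) (Fin n) ℂ)
    (hG : ∀ t' t, G t' t = Matrix.of fun i j => ∫ ω, y t' ω i * star (y t ω j) ∂μ) :
    ∀ t' t, t ≤ t' → G t' t = K ^ (t' - t) * G t t := by
  intro t' t htt'
  induction t', htt' using Nat.le_induction with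
  | base => simp
  | succ s hts ih =>
    have step : G (s + 1) t = K * G s t := by
      ext i j
      have h_noise : ∫ ω, e s ω i * star (y t ω j) ∂μ = 0 := by
        rw [integral_mul_star_comm, integral_state_mul_star_noise_eq_zero K g0 e y hy0 hyrec
          he_mean hee_int hee hye_int hts, star_zero]
      simp only [hG, of_apply, mul_apply, hyrec]
      rw [integral_mulVec_add_mul_star K (y s) (e s) (fun ω => y t ω j)
        (fun k => hyy_int s t k j) i (hey_int s t i j), h_noise, add_zero]
    rw [step, ih, Nat.succ_sub hts, pow_succ', Matrix.mul_assoc]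
end

section
/- Let (Ω, F, μ) be a probability space, n a positive integer, K an n×n complex matrix, g₀ ∈ ℂⁿ a fixed vector, and e : ℕ → Ω → ℂⁿ a sequence of random vectors. Define the random vectors y : ℕ → Ω → ℂⁿ by y_0(ω) = g₀ and y_{t+1}(ω) = K y_t(ω) + e_t(ω). Assume E[e_t] = 0 for every t, E[e_{t'} e_tᴴ] = 0 whenever t' ≠ t, that all outer products appearing are integrable, and additionally that the process is second-order stationary: there is an n×n complex matrix G with E[y_t y_tᴴ] = G for every t. Then for all t ∈ ℕ and all τ ∈ ℕ, E[y_{t+τ} y_tᴴ] = K^τ G. -/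
open Matrix MeasureTheory

/-- In a linear recursion with deterministic initial value driven by uncorrelated mean-zero noise,
the noise is uncorrelated with the present and past states. -/
theorem integral_noise_mul_star_state_eq_zero {Ω ι : Type*} [MeasurableSpace Ω] [Fintype ι]
    {μ : Measure Ω} {K : Matrix ι ι ℂ} {g0 : ι → ℂ} {e y : ℕ → Ω → ι → ℂ}
    (hy0 : ∀ ω, y 0 ω = g0)
    (hyrec : ∀ t ω, y (t + 1) ω = K.mulVec (y t ω) + e t ω)
    (he_mean : ∀ t i, ∫ ω, e t ω i ∂μ = 0)
    (hee_int : ∀ t' t i j, Integrable (fun ω => e t' ω i * star (e t ω j)) μ)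
    (hee : ∀ t' t, t' ≠ t → ∀ i j, ∫ ω, e t' ω i * star (e t ω j) ∂μ = 0)
    (hey_int : ∀ t' t i j, Integrable (fun ω => e t' ω i * star (y t ω j)) μ)
    {s t : ℕ} (hts : t ≤ s) (i j : ι) :
    ∫ ω, e s ω i * star (y t ω j) ∂μ = 0 := by
  induction t generalizing j with
  | zero => simp only [hy0, integral_mul_const, he_mean, zero_mul]
  | succ t ih =>
    have h (ω : Ω) : e s ω i * star (y (t + 1) ω j) =
        (∑ k, star (K j k) * (e s ω i * star (y t ω k))) + e s ω i * star (e t ω j) := by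
      simp only [hyrec, Pi.add_apply, mulVec, dotProduct, star_add, star_sum, star_mul', mul_add,
        Finset.mul_sum, mul_left_comm]
    have hint (k : ι) : Integrable (fun ω => star (K j k) * (e s ω i * star (y t ω k))) μ :=
      (hey_int s t i k).const_mul _
    simp_rw [h]
    rw [integral_add (integrable_finsetSum _ fun k _ => hint k) (hee_int s t i j),
      integral_finsetSum _ fun k _ => hint k, hee s t (by omega)]
    simp only [integral_const_mul, ih (by omega), mul_zero, Finset.sum_const_zero, add_zero]

/-- Corollary to Lemma 1 of the paper: under second-order stationarity
`E[y_t y_tᴴ] = G`, the lagged second moments satisfy `E[y_{t+τ} y_tᴴ] = K^τ G`.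
Expectations of outer products are taken entrywise. -/
theorem stmt_7 {Ω : Type*} [MeasurableSpace Ω] (μ : Measure Ω) [IsProbabilityMeasure μ]
    (n : ℕ) (hn : 0 < n) (K : Matrix (Fin n) (Fin n) ℂ) (g0 : Fin n → ℂ)
    (e y : ℕ → Ω → Fin n → ℂ)
    (hy0 : ∀ ω, y 0 ω = g0)
    (hyrec : ∀ t ω, y (t + 1) ω = K.mulVec (y t ω) + e t ω)
    (he_int : ∀ t i, Integrable (fun ω => e t ω i) μ)
    (he_mean : ∀ t i, ∫ ω, e t ω i ∂μ = 0)
    (hee_int : ∀ t' t i j, Integrable (fun ω => e t' ω i * star (e t ω j)) μ)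
    (hee : ∀ t' t, t' ≠ t → ∀ i j, ∫ ω, e t' ω i * star (e t ω j) ∂μ = 0)
    (hyy_int : ∀ t' t i j, Integrable (fun ω => y t' ω i * star (y t ω j)) μ)
    (hye_int : ∀ t' t i j, Integrable (fun ω => y t' ω i * star (e t ω j)) μ)
    (hey_int : ∀ t' t i j, Integrable (fun ω => e t' ω i * star (y t ω j)) μ)
    (G : Matrix (Fin n) (Fin n) ℂ)
    (hstat : ∀ t, (Matrix.of fun i j => ∫ ω, y t ω i * star (y t ω j) ∂μ) = G) :
    ∀ t τ : ℕ,
      (Matrix.of fun i j => ∫ ω, y (t + τ) ω i * star (y t ω j) ∂μ) = K ^ τ * G := by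
  intro t τ
  induction τ with
  | zero => simpa using hstat t
  | succ τ ih =>
    rw [pow_succ', Matrix.mul_assoc, ← ih]
    ext i j
    have h (ω : Ω) : y (t + (τ + 1)) ω i * star (y t ω j) =
        (∑ k, K i k * (y (t + τ) ω k * star (y t ω j))) + e (t + τ) ω i * star (y t ω j) := by
      simp only [← add_assoc, hyrec, Pi.add_apply, mulVec, dotProduct, add_mul, Finset.sum_mul,
        mul_assoc]
    have hint (k : Fin n) :
        Integrable (fun ω => K i k * (y (t + τ) ω k * star (y t ω j))) μ :=
      (hyy_int (t + τ) t k j).const_mul _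
    simp_rw [mul_apply, of_apply, h]
    rw [integral_add (integrable_finsetSum _ fun k _ => hint k) (hey_int (t + τ) t i j),
      integral_finsetSum _ fun k _ => hint k,
      integral_noise_mul_star_state_eq_zero hy0 hyrec he_mean hee_int hee hey_int
        (Nat.le_add_right t τ), add_zero]
    simp only [integral_const_mul]
end

section
/- Let (Ω, F, μ) be a probability space, n a positive integer, K, Q, R n×n complex matrices, g₀ ∈ ℂⁿ a fixed vector, and e, w : ℕ → Ω → ℂⁿ sequences of random vectors. Define y : ℕ → Ω → ℂⁿ by y_0(ω) = g₀ and y_{t+1}(ω) = K y_t(ω) + e_t(ω), and define the noisy observations h_t(ω) = y_t(ω) + w_t(ω). Assume E[e_t] = 0 and E[w_t] = 0 for every t; E[e_{t'} e_tᴴ] = 0 for t' ≠ t; E[w_{t'} w_tᴴ] = Q if t' = t and 0 otherwise; E[e_{t'} w_tᴴ] = R if t' = t and 0 otherwise; and that all outer products appearing are integrable. Then for all t, t' ∈ ℕ with t' > t, the second-moment matrices H_{t',t} = E[h_{t'} h_tᴴ] satisfy H_{t',t} = K^{t'-t-1} (K G_{t,t} + R), where G_{t,t} = E[y_t y_tᴴ].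 -/
open Matrix MeasureTheory

section CrossMoment

variable {Ω : Type*} [MeasurableSpace Ω] {μ : Measure Ω} {n : ℕ}

/-- The second-moment matrix `E[u vᴴ]`, taken entrywise. -/
noncomputable def crossMoment (μ : Measure Ω) (u v : Ω → Fin n → ℂ) :
    Matrix (Fin n) (Fin n) ℂ :=
  Matrix.of fun i j => ∫ ω, u ω i * star (v ω j) ∂μ

/-- All entries of the outer product `u vᴴ` are integrable. -/
def OuterIntegrable (μ : Measure Ω) (u v : Ω → Fin n → ℂ) : Prop :=
  ∀ i j, Integrable (fun ω => u ω i * star (v ω j)) μ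

theorem OuterIntegrable.add_right {u v v' : Ω → Fin n → ℂ} (hv : OuterIntegrable μ u v)
    (hv' : OuterIntegrable μ u v') : OuterIntegrable μ u (fun ω => v ω + v' ω) := by
  intro i j
  simp only [Pi.add_apply, star_add, mul_add]
  exact (hv i j).add (hv' i j)

theorem crossMoment_conjTranspose (u v : Ω → Fin n → ℂ) :
    (crossMoment μ u v)ᴴ = crossMoment μ v u := by
  ext i j
  simp only [crossMoment, conjTranspose_apply, of_apply, RCLike.star_def]
  rw [← integral_conj]
  simp [mul_comm]

theorem crossMoment_add_right {u v v' : Ω → Fin n → ℂ} (hv : OuterIntegrable μ u v)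
    (hv' : OuterIntegrable μ u v') :
    crossMoment μ u (fun ω => v ω + v' ω) = crossMoment μ u v + crossMoment μ u v' := by
  ext i j
  simp only [crossMoment, of_apply, Matrix.add_apply, Pi.add_apply, star_add, mul_add]
  exact integral_add (hv i j) (hv' i j)

theorem crossMoment_add_left {u u' v : Ω → Fin n → ℂ} (hu : OuterIntegrable μ u v)
    (hu' : OuterIntegrable μ u' v) :
    crossMoment μ (fun ω => u ω + u' ω) v = crossMoment μ u v + crossMoment μ u' v := by
  ext i j
  simp only [crossMoment, of_apply, Matrix.add_apply, Pi.add_apply, add_mul]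
  exact integral_add (hu i j) (hu' i j)

theorem OuterIntegrable.mulVec_left (K : Matrix (Fin n) (Fin n) ℂ) {u v : Ω → Fin n → ℂ}
    (hu : OuterIntegrable μ u v) : OuterIntegrable μ (fun ω => K.mulVec (u ω)) v := by
  intro i j
  simp only [mulVec, dotProduct, Finset.sum_mul, mul_assoc]
  exact integrable_finsetSum _ fun k _ => (hu k j).const_mul _

theorem crossMoment_mulVec_left (K : Matrix (Fin n) (Fin n) ℂ) {u v : Ω → Fin n → ℂ}
    (hu : OuterIntegrable μ u v) :
    crossMoment μ (fun ω => K.mulVec (u ω)) v = K * crossMoment μ u v := by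
  ext i j
  simp only [crossMoment, of_apply, Matrix.mul_apply, mulVec, dotProduct, Finset.sum_mul,
    mul_assoc]
  rw [integral_finsetSum _ fun k _ => (hu k j).const_mul _]
  simp only [integral_const_mul]

theorem crossMoment_const_left (c : Fin n → ℂ) {v : Ω → Fin n → ℂ}
    (hv : ∀ i, ∫ ω, v ω i ∂μ = 0) : crossMoment μ (fun _ => c) v = 0 := by
  ext i j
  simp only [crossMoment, of_apply, integral_const_mul, RCLike.star_def, integral_conj, hv,
    map_zero, mul_zero, Matrix.zero_apply]

variable {K : Matrix (Fin n) (Fin n) ℂ} {e y : ℕ → Ω → Fin n → ℂ} {v : Ω → Fin n → ℂ}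

theorem crossMoment_succ (hyrec : ∀ t ω, y (t + 1) ω = K.mulVec (y t ω) + e t ω)
    (hyv : ∀ t, OuterIntegrable μ (y t) v) (hev : ∀ t, OuterIntegrable μ (e t) v) (t : ℕ) :
    crossMoment μ (y (t + 1)) v = K * crossMoment μ (y t) v + crossMoment μ (e t) v := by
  rw [funext (hyrec t), crossMoment_add_left ((hyv t).mulVec_left K) (hev t),
    crossMoment_mulVec_left K (hyv t)]

/-- A linear recursion started at a constant is uncorrelated with any centred vector that is
uncorrelated with the driving noise so far. -/
theorem crossMoment_eq_zero_of_noise {g : Fin n → ℂ} (hy0 : ∀ ω, y 0 ω = g)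
    (hyrec : ∀ t ω, y (t + 1) ω = K.mulVec (y t ω) + e t ω)
    (hyv : ∀ t, OuterIntegrable μ (y t) v) (hev : ∀ t, OuterIntegrable μ (e t) v)
    (hv : ∀ i, ∫ ω, v ω i ∂μ = 0) {t : ℕ} (h : ∀ s < t, crossMoment μ (e s) v = 0) :
    crossMoment μ (y t) v = 0 := by
  induction t with
  | zero => rw [funext hy0, crossMoment_const_left g hv]
  | succ t ih =>
    rw [crossMoment_succ hyrec hyv hev, ih fun s hs => h s (by omega), h t (by omega),
      mul_zero, add_zero]

theorem crossMoment_add_eq_pow_mul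
    (hyrec : ∀ t ω, y (t + 1) ω = K.mulVec (y t ω) + e t ω)
    (hyv : ∀ t, OuterIntegrable μ (y t) v) (hev : ∀ t, OuterIntegrable μ (e t) v)
    {t : ℕ} (h : ∀ s, t ≤ s → crossMoment μ (e s) v = 0) (k : ℕ) :
    crossMoment μ (y (t + k)) v = K ^ k * crossMoment μ (y t) v := by
  induction k with
  | zero => simp
  | succ k ih =>
    rw [← add_assoc, crossMoment_succ hyrec hyv hev, ih, h _ (by omega), add_zero, pow_succ',
      mul_assoc]

end CrossMoment

/-- Lemma 2 of the paper, case `t' > t`: the second-moment matrices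
`H_{t',t} = E[h_{t'} h_tᴴ]` of the noisy observations `h t = y t + w t`, where
`y (t+1) = K y t + e t`, with zero-mean white process noise `e`, zero-mean white
observation noise `w` of covariance `Q`, and cross-covariance `E[e_t w_tᴴ] = R`,
satisfy `H_{t',t} = K^(t'-t-1) (K G_{t,t} + R)` with `G_{t,t} = E[y_t y_tᴴ]`.
Expectations of outer products are taken entrywise. -/
theorem stmt_8 {Ω : Type*} [MeasurableSpace Ω] (μ : Measure Ω) [IsProbabilityMeasure μ]
    (n : ℕ) (hn : 0 < n) (K Q R : Matrix (Fin n) (Fin n) ℂ) (g0 : Fin n → ℂ)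
    (e w y h : ℕ → Ω → Fin n → ℂ)
    (hy0 : ∀ ω, y 0 ω = g0)
    (hyrec : ∀ t ω, y (t + 1) ω = K.mulVec (y t ω) + e t ω)
    (hh : ∀ t ω, h t ω = y t ω + w t ω)
    (he_int : ∀ t i, Integrable (fun ω => e t ω i) μ)
    (he_mean : ∀ t i, ∫ ω, e t ω i ∂μ = 0)
    (hw_int : ∀ t i, Integrable (fun ω => w t ω i) μ)
    (hw_mean : ∀ t i, ∫ ω, w t ω i ∂μ = 0)
    (hee_int : ∀ t' t i j, Integrable (fun ω => e t' ω i * star (e t ω j)) μ)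
    (hee : ∀ t' t, t' ≠ t → ∀ i j, ∫ ω, e t' ω i * star (e t ω j) ∂μ = 0)
    (hww_int : ∀ t' t i j, Integrable (fun ω => w t' ω i * star (w t ω j)) μ)
    (hww : ∀ t' t, (Matrix.of fun i j => ∫ ω, w t' ω i * star (w t ω j) ∂μ)
      = if t' = t then Q else 0)
    (hew_int : ∀ t' t i j, Integrable (fun ω => e t' ω i * star (w t ω j)) μ)
    (hew : ∀ t' t, (Matrix.of fun i j => ∫ ω, e t' ω i * star (w t ω j) ∂μ)
      = if t' = t then R else 0)
    (hyy_int : ∀ t' t i j, Integrable (fun ω => y t' ω i * star (y t ω j)) μ)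
    (hye_int : ∀ t' t i j, Integrable (fun ω => y t' ω i * star (e t ω j)) μ)
    (hey_int : ∀ t' t i j, Integrable (fun ω => e t' ω i * star (y t ω j)) μ)
    (hyw_int : ∀ t' t i j, Integrable (fun ω => y t' ω i * star (w t ω j)) μ)
    (hwy_int : ∀ t' t i j, Integrable (fun ω => w t' ω i * star (y t ω j)) μ)
    (hhh_int : ∀ t' t i j, Integrable (fun ω => h t' ω i * star (h t ω j)) μ) :
    ∀ t' t, t < t' →
      (Matrix.of fun i j => ∫ ω, h t' ω i * star (h t ω j) ∂μ)
        = K ^ (t' - t - 1) *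
          (K * (Matrix.of fun i j => ∫ ω, y t ω i * star (y t ω j) ∂μ) + R) := by
  intro t' t htt'
  obtain ⟨k, rfl⟩ : ∃ k, t' = t + 1 + k := ⟨t' - (t + 1), by omega⟩
  rw [show t + 1 + k - t - 1 = k by omega]
  change crossMoment μ (h (t + 1 + k)) (h t) = K ^ k * (K * crossMoment μ (y t) (y t) + R)
  have hew' : ∀ a b, crossMoment μ (e a) (w b) = if a = b then R else 0 := hew
  have hww' : ∀ a b, crossMoment μ (w a) (w b) = if a = b then Q else 0 := hww
  have hee' : ∀ a b, a ≠ b → crossMoment μ (e a) (e b) = 0 := by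
    intro a b hab
    ext i j
    exact hee a b hab i j
  have hye : ∀ s, t ≤ s → crossMoment μ (e s) (y t) = 0 := by
    intro s hs
    rw [← crossMoment_conjTranspose, crossMoment_eq_zero_of_noise hy0 hyrec
      (fun a => hye_int a s) (fun a => hee_int a s) (he_mean s)
      fun a ha => hee' a s (by omega), conjTranspose_zero]
  have hyw : ∀ s, t ≤ s → crossMoment μ (y t) (w s) = 0 := by
    intro s hs
    exact crossMoment_eq_zero_of_noise hy0 hyrec
      (fun a => hyw_int a s) (fun a => hew_int a s) (hw_mean s)
      fun a ha => by rw [hew', if_neg (by omega)]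
  have hwy : crossMoment μ (w (t + 1 + k)) (y t) = 0 := by
    rw [← crossMoment_conjTranspose, hyw _ (by omega), conjTranspose_zero]
  have hyh_int : ∀ a, OuterIntegrable μ (y a) (h t) := by
    intro a
    rw [funext (hh t)]
    exact OuterIntegrable.add_right (hyy_int a t) (hyw_int a t)
  have heh_int : ∀ a, OuterIntegrable μ (e a) (h t) := by
    intro a
    rw [funext (hh t)]
    exact OuterIntegrable.add_right (hey_int a t) (hew_int a t)
  have hwh_int : ∀ a, OuterIntegrable μ (w a) (h t) := by
    intro a
    rw [funext (hh t)]
    exact OuterIntegrable.add_right (hwy_int a t) (hww_int a t)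
  have heh : ∀ s, t ≤ s → crossMoment μ (e s) (h t) = if s = t then R else 0 := by
    intro s hs
    rw [funext (hh t), crossMoment_add_right (hey_int s t) (hew_int s t), hye s hs, hew',
      zero_add]
  have hyh : crossMoment μ (y t) (h t) = crossMoment μ (y t) (y t) := by
    rw [funext (hh t), crossMoment_add_right (hyy_int t t) (hyw_int t t), hyw t le_rfl,
      add_zero]
  have hwh : crossMoment μ (w (t + 1 + k)) (h t) = 0 := by
    rw [funext (hh t), crossMoment_add_right (hwy_int _ t) (hww_int _ t), hwy, hww',
      if_neg (by omega), add_zero]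
  rw [funext (hh (t + 1 + k)), crossMoment_add_left (hyh_int _) (hwh_int _), hwh, add_zero,
    crossMoment_add_eq_pow_mul hyrec hyh_int heh_int
      (fun s hs => by rw [heh s (by omega), if_neg (by omega)]),
    crossMoment_succ hyrec hyh_int heh_int, hyh, heh t le_rfl, if_pos rfl]
end

section
/- Let n, m be positive integers, K an n×n complex matrix, and B an n×m complex matrix with rank B = n. Let O be the (2n)×m complex matrix obtained by stacking B on top of K·B (so the first n rows of O are B and the last n rows are K·B). Suppose O = W·Z for some (2n)×n complex matrix W with rank W = n and some n×m complex matrix Z. Write W₁ for the first n rows of W and W₂ for the last n rows of W. Then W₁ is invertible and W₂ W₁^{-1} = K. -/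
open Matrix

/-- A matrix of full row rank over a field has a right inverse. -/
theorem Matrix.exists_mul_eq_one_of_rank_eq_card {F m n : Type*} [Field F] [Fintype m]
    [DecidableEq m] [Fintype n] [DecidableEq n] {A : Matrix m n F}
    (hA : A.rank = Fintype.card m) : ∃ R : Matrix n m F, A * R = 1 := by
  rw [← Matrix.mulVec_surjective_iff_exists_right_inverse]
  have hrange : LinearMap.range A.mulVecLin = ⊤ :=
    Submodule.eq_top_of_finrank_eq (by simpa [Matrix.rank] using hA)
  exact LinearMap.range_eq_top.mp hrange

/-- Deterministic core of Theorem 1 (subspace DMD): if `O` is the stack of `B` (full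
row rank) on top of `K * B`, then any rank-`n` factorization `O = W * Z` recovers
`K` as `W₂ * W₁⁻¹`, where `W₁` and `W₂` are the top and bottom `n` rows of `W`. -/
theorem stmt_11 (n m : ℕ) (hn : 0 < n) (hm : 0 < m)
    (K : Matrix (Fin n) (Fin n) ℂ) (B : Matrix (Fin n) (Fin m) ℂ)
    (hB : B.rank = n)
    (W : Matrix (Fin n ⊕ Fin n) (Fin n) ℂ) (Z : Matrix (Fin n) (Fin m) ℂ)
    (hW : W.rank = n)
    (hfact : Matrix.fromRows B (K * B) = W * Z) :
    IsUnit (W.submatrix Sum.inl id) ∧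
      W.submatrix Sum.inr id * (W.submatrix Sum.inl id)⁻¹ = K := by
  obtain ⟨R, hR⟩ := Matrix.exists_mul_eq_one_of_rank_eq_card (A := B) (by simpa using hB)
  have htop : B = W.submatrix Sum.inl id * Z := by
    ext i j
    exact congrFun (congrFun hfact (Sum.inl i)) j
  have hbot : K * B = W.submatrix Sum.inr id * Z := by
    ext i j
    exact congrFun (congrFun hfact (Sum.inr i)) j
  have hinv : W.submatrix Sum.inl id * (Z * R) = 1 := by
    rw [← Matrix.mul_assoc, ← htop, hR]
  refine ⟨IsUnit.of_mul_eq_one _ hinv, ?_⟩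
  rw [Matrix.inv_eq_right_inv hinv, ← Matrix.mul_assoc, ← hbot, Matrix.mul_assoc, hR,
    Matrix.mul_one]
end

section
/- Let n be a positive integer and let K, G, Q, R be n×n complex matrices. Set D = K·G + R and suppose D is invertible. Define H_τ = K^{τ-1}·D for integers τ ≥ 1, and let M be the (2n)×(2n) complex block matrix M = [[H_2, H_1],[H_3, H_2]] (i.e., top-left block H_2 = K·D, top-right block H_1 = D, bottom-left block H_3 = K²·D, bottom-right block H_2 = K·D). Then: (i) rank M = n; and (ii) for every factorization M = W·Z with W a (2n)×n complex matrix of rank n and Z an n×(2n) complex matrix, writing W₁ for the first n rows and W₂ for the last n rows of W, the matrix W₁ is invertible and W₂ W₁^{-1} = K. -/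
open Matrix

theorem Matrix.fromRows_one_mul_fromCols {n : Type*} [Fintype n] [DecidableEq n]
    {S : Type*} [Semiring S] (K A B : Matrix n n S) :
    fromRows 1 K * fromCols A B = fromBlocks A B (K * A) (K * B) := by
  simp

theorem Matrix.rank_fromRows_one_mul_fromCols {n : Type*} [Fintype n] [DecidableEq n]
    {F : Type*} [Field F] (K A : Matrix n n F) {B : Matrix n n F} (hB : IsUnit B) :
    (fromRows (1 : Matrix n n F) K * fromCols A B).rank = Fintype.card n := by
  refine le_antisymm ((rank_mul_le_left _ _).trans (rank_le_card_width _)) ?_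
  have h : (fromRows (1 : Matrix n n F) K * fromCols A B).submatrix Sum.inl Sum.inr = B := by
    rw [fromRows_one_mul_fromCols]
    rfl
  have hle := rank_submatrix_le (fromRows (1 : Matrix n n F) K * fromCols A B) Sum.inl Sum.inr
  rwa [h, rank_of_isUnit B hB] at hle

/-- Algebraic content of Theorem 1 (subspace DMD): with `D = K * G + R` invertible and
`H τ = K^(τ-1) * D` for `τ ≥ 1`, the block matrix `M = [[H 2, H 1], [H 3, H 2]]` has
rank `n`, and every rank-`n` factorization `M = W * Z` recovers `K` as `W₂ * W₁⁻¹`. -/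
theorem stmt_12 (n : ℕ) (hn : 0 < n)
    (K G Q R D : Matrix (Fin n) (Fin n) ℂ)
    (hD : D = K * G + R) (hDinv : IsUnit D)
    (H : ℕ → Matrix (Fin n) (Fin n) ℂ)
    (hH : ∀ τ : ℕ, 1 ≤ τ → H τ = K ^ (τ - 1) * D)
    (Mb : Matrix (Fin n ⊕ Fin n) (Fin n ⊕ Fin n) ℂ)
    (hMb : Mb = Matrix.fromBlocks (H 2) (H 1) (H 3) (H 2)) :
    Mb.rank = n ∧
      ∀ (W : Matrix (Fin n ⊕ Fin n) (Fin n) ℂ) (Z : Matrix (Fin n) (Fin n ⊕ Fin n) ℂ),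
        W.rank = n → Mb = W * Z →
        IsUnit (W.submatrix Sum.inl id) ∧
          W.submatrix Sum.inr id * (W.submatrix Sum.inl id)⁻¹ = K := by
  have hM : Mb = fromRows (1 : Matrix (Fin n) (Fin n) ℂ) K * fromCols (K * D) D := by
    rw [hMb, fromRows_one_mul_fromCols, hH 1 le_rfl, hH 2 (by norm_num), hH 3 (by norm_num)]
    simp [pow_two, Matrix.mul_assoc]
  refine ⟨by simpa [hM] using rank_fromRows_one_mul_fromCols K (K * D) hDinv, ?_⟩
  intro W Z _ hWZ
  rw [hM, fromRows_one_mul_fromCols] at hWZ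
  have h₁ : W.submatrix Sum.inl id * Z.submatrix id Sum.inr = D :=
    (congrArg (fun A => A.submatrix Sum.inl Sum.inr) hWZ).symm
  have h₂ : W.submatrix Sum.inr id * Z.submatrix id Sum.inr = K * D :=
    (congrArg (fun A => A.submatrix Sum.inr Sum.inr) hWZ).symm
  have hW : IsUnit (W.submatrix Sum.inl id) := isUnit_of_mul_isUnit_left (h₁ ▸ hDinv)
  have hZ : IsUnit (Z.submatrix id Sum.inr) := isUnit_of_mul_isUnit_right (h₁ ▸ hDinv)
  have hK : W.submatrix Sum.inr id = K * W.submatrix Sum.inl id := by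
    refine hZ.mul_right_cancel ?_
    rw [h₂, Matrix.mul_assoc, h₁]
  refine ⟨hW, ?_⟩
  rw [hK]
  exact mul_nonsing_inv_cancel_right _ _ ((isUnit_iff_isUnit_det _).mp hW)
end
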